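/- Let φ : R → S be a homomorphism of commutative rings. Then the multiplication map μ : S ⊗_R S → S, s ⊗ t ↦ st, is bijective and Tor_i^R(S, S) = 0 for all i ≥ 1 if and only if for all S-modules M, M' and all i ≥ 0 the natural map Ext^i_S(M, M') → Ext^i_R(M, M') induced by restriction of scalars is an isomorphism. -/

import Mathlib

/-!
Homological epimorphisms of rings (Geigle–Lenzing).
`φ : R →+* S`; every `S`-module is an `R`-module by restriction of scalars.
-/

universe w u

open CategoryTheory Limits DerivedCategory

noncomputable section

namespace RingHomEpi

variable {R S : Type u} [CommRing R] [CommRing S] (φ : R →+* S)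

instance : (ModuleCat.restrictScalars.{u} φ).Additive where
  map_add := rfl

/-- `S` regarded as an `R`-module via `φ`. -/
abbrev SasR : ModuleCat.{u} R := (ModuleCat.restrictScalars φ).obj (ModuleCat.of S S)

/-- The canonical map `η_M : M → Hom_R(S, M)`, `m ↦ (s ↦ s • m)`. -/
def etaMap (M : ModuleCat.{u} S) :
    M → (SasR φ →ₗ[R] (ModuleCat.restrictScalars φ).obj M) := fun m =>
  { toFun := fun s => (show S from s) • (show M from m)
    map_add' := fun s t => add_smul (show S from s) (show S from t) (show M from m)
    map_smul' := fun r s => by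
      show (φ r • (show S from s)) • (show M from m) =
        φ r • ((show S from s) • (show M from m))
      exact smul_assoc (φ r) (show S from s) (show M from m) }

/-- The action of `S` on an `S`-module `M`, as an `R`-bilinear map. -/
def actionBilin (M : ModuleCat.{u} S) :
    SasR φ →ₗ[R]
      ((ModuleCat.restrictScalars φ).obj M →ₗ[R] (ModuleCat.restrictScalars φ).obj M) where
  toFun s :=
    { toFun := fun m => (show S from s) • (show M from m)
      map_add' := fun m m' => smul_add (show S from s) (show M from m) (show M from m')
      map_smul' := fun r m => by
        show (show S from s) • (φ r • (show M from m)) =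
          φ r • ((show S from s) • (show M from m))
        rw [smul_comm] }
  map_add' s t := LinearMap.ext fun m => add_smul (show S from s) (show S from t) (show M from m)
  map_smul' r s := LinearMap.ext fun m => by
    show (φ r • (show S from s)) • (show M from m) =
      φ r • ((show S from s) • (show M from m))
    exact smul_assoc (φ r) (show S from s) (show M from m)

/-- The action map `α_M : S ⊗_R M → M`, `s ⊗ m ↦ s • m`. -/
def actionMap (M : ModuleCat.{u} S) :
    TensorProduct R (SasR φ) ((ModuleCat.restrictScalars φ).obj M) →ₗ[R]
      (ModuleCat.restrictScalars φ).obj M :=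
  TensorProduct.lift (actionBilin φ M)

/-- The multiplication map `μ : S ⊗_R S → S`, `s ⊗ t ↦ s * t`. -/
def mulMap : TensorProduct R (SasR φ) (SasR φ) →ₗ[R] SasR φ :=
  actionMap φ (ModuleCat.of S S)

/-- Restriction of scalars is compatible with the forgetful functors to abelian groups. -/
def restrictScalarsCompForget₂Iso :
    ModuleCat.restrictScalars.{u} φ ⋙ forget₂ (ModuleCat.{u} R) AddCommGrpCat ≅
      forget₂ (ModuleCat.{u} S) AddCommGrpCat :=
  NatIso.ofComponents (fun _ => Iso.refl _) (fun _ => rfl)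

instance : PreservesFiniteLimits (ModuleCat.restrictScalars.{u} φ) := by
  have : PreservesFiniteLimits
      (ModuleCat.restrictScalars.{u} φ ⋙ forget₂ (ModuleCat.{u} R) AddCommGrpCat) :=
    preservesFiniteLimits_of_natIso (restrictScalarsCompForget₂Iso φ).symm
  exact preservesFiniteLimits_of_reflects_of_preserves _
    (forget₂ (ModuleCat.{u} R) AddCommGrpCat)

instance : PreservesFiniteColimits (ModuleCat.restrictScalars.{u} φ) := by
  have : PreservesFiniteColimits
      (ModuleCat.restrictScalars.{u} φ ⋙ forget₂ (ModuleCat.{u} R) AddCommGrpCat) :=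
    preservesFiniteColimits_of_natIso (restrictScalarsCompForget₂Iso φ).symm
  exact preservesFiniteColimits_of_reflects_of_preserves _
    (forget₂ (ModuleCat.{u} R) AddCommGrpCat)

attribute [local instance] CategoryTheory.hasExt_of_hasDerivedCategory

variable [HasDerivedCategory.{w} (ModuleCat.{u} R)]
  [HasDerivedCategory.{w} (ModuleCat.{u} S)]

/-- The functor `D(φ) : D(S) → D(R)` induced by restriction of scalars along `φ`. -/
abbrev Dphi : DerivedCategory (ModuleCat.{u} S) ⥤ DerivedCategory (ModuleCat.{u} R) :=
  (ModuleCat.restrictScalars.{u} φ).mapDerivedCategory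

/-- `D(φ)` commutes with the single complex functors. -/
def singleObjIso (M : ModuleCat.{u} S) :
    (Dphi φ).obj ((DerivedCategory.singleFunctor (ModuleCat.{u} S) 0).obj M) ≅
      (DerivedCategory.singleFunctor (ModuleCat.{u} R) 0).obj
        ((ModuleCat.restrictScalars φ).obj M) :=
  (Dphi φ).mapIso
    (((SingleFunctors.evaluation _ _ 0).mapIso
      (DerivedCategory.singleFunctorsPostcompQIso (ModuleCat.{u} S))).app M)
  ≪≫ ((ModuleCat.restrictScalars.{u} φ).mapDerivedCategoryFactors.app _)
  ≪≫ DerivedCategory.Q.mapIso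
      ((HomologicalComplex.singleMapHomologicalComplex
        (ModuleCat.restrictScalars.{u} φ) (ComplexShape.up ℤ) 0).app M)
  ≪≫ (((SingleFunctors.evaluation _ _ 0).mapIso
      (DerivedCategory.singleFunctorsPostcompQIso (ModuleCat.{u} R))).symm.app _)

/-- The natural comparison map `Ext^n_S(M, M') → Ext^n_R(M, M')` induced by
restriction of scalars along `φ`. -/
def extMap {M M' : ModuleCat.{u} S} {n : ℕ} (e : Abelian.Ext.{w} M M' n) :
    Abelian.Ext.{w} ((ModuleCat.restrictScalars φ).obj M)
      ((ModuleCat.restrictScalars φ).obj M') n :=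
  Abelian.Ext.homEquiv.symm
    ((singleObjIso φ M).inv ≫ (Dphi φ).map e.hom ≫
      ((Dphi φ).commShiftIso (n : ℤ)).hom.app _ ≫
      (shiftFunctor (DerivedCategory (ModuleCat.{u} R)) (n : ℤ)).map
        (singleObjIso φ M').hom)



end RingHomEpi

namespace RingHomEpi

section Aux

variable {R S : Type u} [CommRing R] [CommRing S] (φ : R →+* S)

open CategoryTheory.Abelian TensorProduct

lemma subsingleton_ext_iff {C : Type*} [Category* C] [Abelian C] [HasExt.{w} C]
    {X Y : C} (P : ProjectiveResolution X) (n : ℕ) :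
    Subsingleton (Ext.{w} X Y (n + 1)) ↔
      ∀ f : P.complex.X (n + 1) ⟶ Y, P.complex.d (n + 2) (n + 1) ≫ f = 0 →
        ∃ g : P.complex.X n ⟶ Y, P.complex.d (n + 1) n ≫ g = f := by
  constructor
  · intro h f hf
    exact (P.extMk_eq_zero_iff f (n + 2) rfl hf n rfl).1 (Subsingleton.elim _ _)
  · intro h
    refine ⟨fun a b => ?_⟩
    have : ∀ a : Ext.{w} X Y (n + 1), a = 0 := fun a => by
      obtain ⟨f, hf, rfl⟩ := P.extMk_surjective a (n + 2) rfl
      exact (P.extMk_eq_zero_iff f (n + 2) rfl hf n rfl).2 (h f hf)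
    rw [this a, this b]

/-- The extended complex. -/
abbrev ext_sc {X : ModuleCat.{u} R} (P : ProjectiveResolution X) (n : ℕ) :
    ShortComplex (ModuleCat.{u} S) :=
  ShortComplex.mk ((ModuleCat.extendScalars.{u} φ).map (P.complex.d (n + 2) (n + 1)))
    ((ModuleCat.extendScalars.{u} φ).map (P.complex.d (n + 1) n)) (by
      rw [← Functor.map_comp, P.complex.d_comp_d]
      have := (ModuleCat.extendRestrictScalarsAdj.{u} φ).left_adjoint_additive
      exact Functor.map_zero _ _ _)

lemma tor_isZero_iff (P : ProjectiveResolution (SasR φ)) (n : ℕ) :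
    IsZero (((Tor (ModuleCat.{u} R) (n + 1)).obj (SasR φ)).obj (SasR φ)) ↔
      (ext_sc φ P n).Exact := by
  refine (P.isoLeftDerivedObj
    ((MonoidalCategory.tensoringLeft (ModuleCat.{u} R)).obj (SasR φ)) (n + 1)).isZero_iff.trans ?_
  refine (HomologicalComplex.exactAt_iff_isZero_homology _ _).symm.trans ?_
  rw [HomologicalComplex.exactAt_iff' _ (n + 2) (n + 1) n (by simp) (by simp),
    ShortComplex.ShortExact.moduleCat_exact_iff_function_exact,
    ShortComplex.ShortExact.moduleCat_exact_iff_function_exact]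
  exact Iff.rfl

/-- Cocycles factor, on the level of the extended complex. -/
lemma factor_iff {X : ModuleCat.{u} R} (P : ProjectiveResolution X) (n : ℕ) (M : ModuleCat.{u} S) :
    (∀ f : P.complex.X (n + 1) ⟶ (ModuleCat.restrictScalars φ).obj M,
      P.complex.d (n + 2) (n + 1) ≫ f = 0 →
        ∃ g : P.complex.X n ⟶ (ModuleCat.restrictScalars φ).obj M,
          P.complex.d (n + 1) n ≫ g = f) ↔
    (∀ f : (ext_sc φ P n).X₂ ⟶ M, (ext_sc φ P n).f ≫ f = 0 →
      ∃ g : (ext_sc φ P n).X₃ ⟶ M, (ext_sc φ P n).g ≫ g = f) := by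
  let adj := ModuleCat.extendRestrictScalarsAdj.{u} φ
  have hnat : ∀ {A B : ModuleCat.{u} R} (d : A ⟶ B)
      (f : (ModuleCat.extendScalars φ).obj B ⟶ M),
      adj.homEquiv _ _ ((ModuleCat.extendScalars φ).map d ≫ f) = d ≫ adj.homEquiv _ _ f :=
    fun d f => adj.homEquiv_naturality_left d f
  have hz : ∀ {A : ModuleCat.{u} R}, adj.homEquiv A M 0 = 0 := by
    intro A
    simp [Adjunction.homEquiv_unit]
  constructor
  · intro h f hf
    obtain ⟨g, hg⟩ := h (adj.homEquiv _ _ f) (by rw [← hnat, ← hz]; exact congrArg _ hf)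
    refine ⟨(adj.homEquiv _ _).symm g, (adj.homEquiv _ _).injective ?_⟩
    refine (hnat _ _).trans ?_
    simpa using hg
  · intro h f hf
    obtain ⟨g, hg⟩ := h ((adj.homEquiv _ _).symm f) ((adj.homEquiv _ _).injective (by
      refine (hnat _ _).trans ?_
      rw [hz]
      simpa using hf))
    refine ⟨adj.homEquiv _ _ g, ?_⟩
    rw [← hnat, show (ModuleCat.extendScalars φ).map (P.complex.d (n + 1) n) ≫ g = _ from hg]
    simp

/-- Factoring all cocycles implies exactness. -/
lemma exact_of_factor (T : ShortComplex (ModuleCat.{u} S))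
    (h : ∀ (M : ModuleCat.{u} S) (f : T.X₂ ⟶ M), T.f ≫ f = 0 → ∃ g : T.X₃ ⟶ M, T.g ≫ g = f) :
    T.Exact := by
  obtain ⟨g, hg⟩ := h _ (cokernel.π T.f) (cokernel.condition _)
  rw [ShortComplex.exact_iff_kernel_ι_comp_cokernel_π_zero, ← hg]
  simp

lemma factor_of_split (T : ShortComplex (ModuleCat.{u} S)) (hT : T.Exact)
    (h : T.X₃ ⟶ T.X₂) (hh : T.g ≫ h ≫ T.g = T.g) [Projective T.X₂] :
    (∃ h' : T.X₂ ⟶ T.X₁, T.f ≫ h' ≫ T.f = T.f) ∧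
    ∀ (M : ModuleCat.{u} S) (f : T.X₂ ⟶ M), T.f ≫ f = 0 → ∃ g : T.X₃ ⟶ M, T.g ≫ g = f := by
  have h0 : (𝟙 _ - T.g ≫ h) ≫ T.g = 0 := by simp [hh]
  have h1 := hT.liftFromProjective_comp _ h0
  constructor
  · refine ⟨hT.liftFromProjective _ h0, ?_⟩
    rw [h1]; simp
  · intro M f hf
    refine ⟨h ≫ f, ?_⟩
    have : (𝟙 _ - T.g ≫ h) ≫ f = 0 := by
      rw [← h1, Category.assoc, hf, comp_zero]
    rw [Preadditive.sub_comp, sub_eq_zero] at this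
    simpa using this.symm

lemma projective_extend {X : ModuleCat.{u} R} [hX : Projective X] :
    Projective ((ModuleCat.extendScalars.{u} φ).obj X) :=
  (ModuleCat.extendRestrictScalarsAdj.{u} φ).map_projective X hX

lemma projective_extend_self (h : Function.Bijective (mulMap φ)) :
    Projective ((ModuleCat.extendScalars.{u} φ).obj (SasR φ)) := by
  let c : (ModuleCat.extendScalars.{u} φ).obj (SasR φ) ⟶ ModuleCat.of S S :=
    ModuleCat.ExtendRestrictScalarsAdj.Counit.map φ
  have hc : Function.Bijective c := h
  have : IsIso c := (ConcreteCategory.isIso_iff_bijective c).2 hc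
  have hp : Projective (ModuleCat.of S S) :=
    (IsProjective.iff_projective S).1 inferInstance
  exact Projective.of_iso (asIso c).symm hp

lemma base_split (h : Function.Bijective (mulMap φ)) (P : ProjectiveResolution (SasR φ)) :
    ∃ h : (ext_sc φ P 0).X₃ ⟶ (ext_sc φ P 0).X₂,
      (ext_sc φ P 0).g ≫ h ≫ (ext_sc φ P 0).g = (ext_sc φ P 0).g := by
  let E := ModuleCat.extendScalars.{u} φ
  have hadd : E.Additive := (ModuleCat.extendRestrictScalarsAdj.{u} φ).left_adjoint_additive
  have hE : ((ShortComplex.mk _ _ P.complex_d_comp_π_f_zero).map E).Exact := by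
    rw [ShortComplex.ShortExact.moduleCat_exact_iff_function_exact]
    refine _root_.lTensor_exact (SasR φ) (f := (P.complex.d 1 0).hom) (g := (P.π.f 0).hom) ?_ ?_
    · exact (ShortComplex.ShortExact.moduleCat_exact_iff_function_exact _).1 P.exact₀
    · exact (ModuleCat.epi_iff_surjective (P.π.f 0)).1 inferInstance
  have := projective_extend_self φ h
  have hepi : Epi (E.map (P.π.f 0)) := inferInstance
  have hP0 : Projective (E.obj (P.complex.X 0)) := projective_extend φ
  let p : E.obj (P.complex.X 0) ⟶ E.obj (SasR φ) := E.map (P.π.f 0)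
  have hpepi : Epi p := hepi
  let s : E.obj (SasR φ) ⟶ E.obj (P.complex.X 0) := Projective.factorThru (𝟙 _) p
  have hs : s ≫ p = 𝟙 _ := Projective.factorThru_comp _ _
  have hP0' : Projective (((ShortComplex.mk _ _ P.complex_d_comp_π_f_zero).map E).X₂) := hP0
  have h0 : (𝟙 (E.obj (P.complex.X 0)) - p ≫ s) ≫ p = 0 := by simp [hs]
  refine ⟨hE.liftFromProjective _ h0, ?_⟩
  have h1 := hE.liftFromProjective_comp _ h0
  have h2 : E.map (P.complex.d 1 0) ≫ p = 0 :=
    ((ShortComplex.mk _ _ P.complex_d_comp_π_f_zero).map E).zero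
  change E.map (P.complex.d 1 0) ≫ _ ≫ E.map (P.complex.d 1 0) = E.map (P.complex.d 1 0)
  refine (congrArg (E.map (P.complex.d 1 0) ≫ ·) h1).trans ?_
  change E.map (P.complex.d 1 0) ≫ (𝟙 (E.obj (P.complex.X 0)) - p ≫ s) = _
  have h3 : E.map (P.complex.d 1 0) ≫ p ≫ s = 0 := by
    rw [← Category.assoc, h2, zero_comp]
  refine (Preadditive.comp_sub _ _ _).trans ?_
  rw [h3, sub_zero]
  exact Category.comp_id _

lemma all_split (h : Function.Bijective (mulMap φ)) (P : ProjectiveResolution (SasR φ))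
    (hP : ∀ n, (ext_sc φ P n).Exact) (n : ℕ) :
    ∃ h : (ext_sc φ P n).X₃ ⟶ (ext_sc φ P n).X₂,
      (ext_sc φ P n).g ≫ h ≫ (ext_sc φ P n).g = (ext_sc φ P n).g := by
  induction n with
  | zero => exact base_split φ h P
  | succ n ih =>
    obtain ⟨h, hh⟩ := ih
    have : Projective (ext_sc φ P n).X₂ := projective_extend φ
    exact (factor_of_split _ (hP n) h hh).1

lemma ext_self_subsingleton [HasExt.{w} (ModuleCat.{u} R)] (h : Function.Bijective (mulMap φ))
    (hT : ∀ i : ℕ, 1 ≤ i → IsZero (((Tor (ModuleCat.{u} R) i).obj (SasR φ)).obj (SasR φ)))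
    (M : ModuleCat.{u} S) (n : ℕ) :
    Subsingleton (Ext.{w} (SasR φ) ((ModuleCat.restrictScalars φ).obj M) (n + 1)) := by
  let P := projectiveResolution (SasR φ)
  have hP : ∀ n, (ext_sc φ P n).Exact := fun n => (tor_isZero_iff φ P n).1 (hT _ (by lia))
  rw [subsingleton_ext_iff P, factor_iff]
  obtain ⟨k, hk⟩ := all_split φ h P hP n
  have : Projective (ext_sc φ P n).X₂ := projective_extend φ
  exact (factor_of_split _ (hP n) k hk).2 M

lemma tor_of_ext [HasExt.{w} (ModuleCat.{u} R)] (n : ℕ)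
    (h : ∀ M : ModuleCat.{u} S,
      Subsingleton (Ext.{w} (SasR φ) ((ModuleCat.restrictScalars φ).obj M) (n + 1))) :
    IsZero (((Tor (ModuleCat.{u} R) (n + 1)).obj (SasR φ)).obj (SasR φ)) := by
  let P := projectiveResolution (SasR φ)
  rw [tor_isZero_iff φ P n]
  refine exact_of_factor _ fun M => ?_
  rw [← factor_iff, ← subsingleton_ext_iff.{w} P]
  exact h M

/-- The pure tensor `a ⊗ b` in `S ⊗_R S`. -/
abbrev pureT (a b : S) : TensorProduct R (SasR φ) (SasR φ) :=
  TensorProduct.tmul R (show SasR φ from a) (show SasR φ from b)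

lemma full_of_mul (h : Function.Bijective (mulMap φ)) :
    (ModuleCat.restrictScalars.{u} φ).Full where
  map_surjective {M N} f := by
    have key : ∀ (s : S) (m : M), f.hom (s • m : M) = (s • (show N from f.hom m) : N) := by
      intro s m
      have h1 : pureT φ s 1 = pureT φ 1 s := by
        apply h.1
        change (s * 1 : S) = (1 * s : S)
        rw [mul_one, one_mul]
      let t : SasR φ →ₗ[R] (ModuleCat.restrictScalars φ).obj N := f.hom ∘ₗ etaMap φ M m
      have h2 := congrArg (fun x => actionMap φ N ((t.lTensor (SasR φ)) x)) h1
      have h3 : (s • (show N from f.hom ((1 : S) • m : M)) : N) =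
        ((1 : S) • (show N from f.hom (s • m : M)) : N) := h2
      rw [one_smul, one_smul] at h3
      exact h3.symm
    exact ⟨ModuleCat.ofHom
      { toFun := fun m => f.hom m
        map_add' := fun a b => f.hom.map_add a b
        map_smul' := key }, rfl⟩

lemma mul_of_full (hF : (ModuleCat.restrictScalars.{u} φ).Full) :
    Function.Bijective (mulMap φ) := by
  let E := ModuleCat.extendScalars.{u} φ
  let j : SasR φ ⟶ (ModuleCat.restrictScalars φ).obj (E.obj (SasR φ)) :=
    (ModuleCat.extendRestrictScalarsAdj.{u} φ).unit.app (SasR φ)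
  obtain ⟨k, hk⟩ := hF.map_surjective j
  have hk' : ∀ s : S, k.hom s = pureT φ 1 s := fun s => by
    change ((ModuleCat.restrictScalars.{u} φ).map k).hom s = _
    rw [hk]; rfl
  have h0 : ∀ a b : S, pureT φ 1 (a * b) = pureT φ a b := by
    intro a b
    have h2 : k.hom (a • b) = a • k.hom b := k.hom.map_smul a b
    have h4 : a • k.hom b = pureT φ (a * 1) b :=
      (congrArg (fun z => a • z) (hk' b)).trans rfl
    rw [mul_one] at h4
    exact (hk' (a * b)).symm.trans (h2.trans h4)
  have h1 : ∀ a b : S, pureT φ a b = pureT φ (a * b) 1 := by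
    intro a b
    rw [← h0 a b, ← h0 (a * b) 1, mul_one]
  constructor
  · have h3 : ∀ x, x = pureT φ (mulMap φ x) 1 := by
      intro x
      induction x using TensorProduct.induction_on with
      | zero => rw [map_zero]; exact (TensorProduct.zero_tmul _ _).symm
      | add a b ha hb =>
        rw [map_add]
        exact (congrArg₂ (· + ·) ha hb).trans (TensorProduct.add_tmul _ _ _).symm
      | tmul a b => exact h1 a b
    intro x y hxy
    rw [h3 x, h3 y, hxy]
  · intro s
    refine ⟨pureT φ s 1, ?_⟩
    change ((show S from s) * (1 : S) : S) = s
    exact mul_one _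

lemma ext_coproduct {C : Type*} [Category* C] [Abelian C] [HasExt.{w} C] [EnoughInjectives C]
    {ι : Type*} {X : ι → C} (c : Cofan X) (hc : IsColimit c) (n : ℕ) (Y : C)
    (h : ∀ i, Subsingleton (Ext.{w} (X i) Y (n + 1))) :
    Subsingleton (Ext.{w} c.pt Y (n + 1)) := by
  induction n generalizing Y with
  | zero =>
    let I : InjectivePresentation Y := Classical.arbitrary _
    let T := ShortComplex.mk _ _ (cokernel.condition I.f)
    have hT : T.ShortExact := { exact := ShortComplex.exact_cokernel I.f }
    have hI : Injective T.X₂ := I.injective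
    refine subsingleton_of_forall_eq 0 fun a => ?_
    obtain ⟨x, rfl⟩ := Ext.covariant_sequence_exact₁ _ hT a
      (Ext.eq_zero_of_injective _) (zero_add 1)
    obtain ⟨v, rfl⟩ := (Ext.mk₀_bijective _ _).2 x
    have : ∀ i, ∃ w : X i ⟶ T.X₂, w ≫ T.g = c.inj i ≫ v := fun i => by
      obtain ⟨y, hy⟩ := Ext.covariant_sequence_exact₃ (X i) hT (Ext.mk₀ (c.inj i ≫ v))
        (zero_add 1) ((h i).elim _ _)
      obtain ⟨y, rfl⟩ := (Ext.mk₀_bijective _ _).2 y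
      refine ⟨y, (Ext.mk₀_bijective _ _).1 ?_⟩
      simpa using hy
    choose q hq using this
    have hv : Cofan.IsColimit.desc hc q ≫ T.g = v :=
      Cofan.IsColimit.hom_ext hc _ _ fun i => by simp [hq]
    rw [← hv, ← Ext.mk₀_comp_mk₀, Ext.comp_assoc_of_second_deg_zero, hT.comp_extClass, Ext.comp_zero]
  | succ n ih =>
    let I : InjectivePresentation Y := Classical.arbitrary _
    let T := ShortComplex.mk _ _ (cokernel.condition I.f)
    have hT : T.ShortExact := { exact := ShortComplex.exact_cokernel I.f }
    have hI : Injective T.X₂ := I.injective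
    have := ih T.X₃ fun i => subsingleton_of_forall_eq 0 fun a => by
      obtain ⟨y, rfl⟩ := Ext.covariant_sequence_exact₃ (X i) hT a rfl ((h i).elim _ _)
      rw [Ext.eq_zero_of_injective y, Ext.zero_comp]
    refine subsingleton_of_forall_eq 0 fun a => ?_
    obtain ⟨x, rfl⟩ := Ext.covariant_sequence_exact₁ _ hT a
      (Ext.eq_zero_of_injective _) rfl
    rw [Subsingleton.elim x 0, Ext.zero_comp]

attribute [local simp] Ext.mapExactFunctor_comp Ext.mapExactFunctor_mk₀ Ext.mapExactFunctor_extClass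

attribute [local instance] Ext.subsingleton_of_projective

lemma mapExt_bijective {C D : Type*} [Category* C] [Abelian C] [Category* D] [Abelian D]
    (F : C ⥤ D) [F.Additive] [PreservesFiniteLimits F] [PreservesFiniteColimits F]
    [F.Full] [F.Faithful] [HasExt.{w} C] [HasExt.{w} D] (Y : C)
    (H : ∀ X : C, ∃ (P : C) (p : P ⟶ X), Projective P ∧ Epi p ∧
      ∀ n, Subsingleton (Ext.{w} (F.obj P) (F.obj Y) (n + 1))) (X : C) (n : ℕ) :
    Function.Bijective (F.mapExtAddHom X Y n) := by
  induction n generalizing X with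
  | zero => simpa [Ext.mapExactFunctor₀] using
      ⟨Functor.Faithful.map_injective, Functor.Full.map_surjective⟩
  | succ n hn =>
    obtain ⟨P, p, hP, hp, hPY⟩ := H X
    let S := ShortComplex.mk _ _ (kernel.condition p)
    have hP' : Projective S.X₂ := hP
    have : Subsingleton (Ext.{w} (S.map F).X₂ (F.obj Y) (n + 1)) := hPY n
    have hS : S.ShortExact := { exact := ShortComplex.exact_kernel p }
    exact AddMonoidHom.bijective_of_surjective_of_bijective_of_right_exact _ _ _ _
      (F.mapExtAddHom S.X₂ Y n) (F.mapExtAddHom S.X₁ Y n) (F.mapExtAddHom S.X₃ Y (n + 1))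
      (by cat_disch) (by cat_disch)
      ((ShortComplex.ab_exact_iff_function_exact _).1
        (Ext.contravariant_sequence_exact₁' hS Y n (n + 1) (add_comm 1 n)))
      ((ShortComplex.ab_exact_iff_function_exact _).1
        (Ext.contravariant_sequence_exact₁' (hS.map F) (F.obj Y) n (n + 1) (add_comm 1 n)))
      (hn _).surjective (hn _)
      (fun x₃ ↦ Ext.contravariant_sequence_exact₃ hS _ x₃ (by subsingleton) (add_comm 1 n))
      (fun y₃ ↦ Ext.contravariant_sequence_exact₃ (hS.map F) _ y₃ (by subsingleton) (add_comm 1 n))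

lemma exists_cover [HasExt.{w} (ModuleCat.{u} R)] (h : Function.Bijective (mulMap φ))
    (hT : ∀ i : ℕ, 1 ≤ i → IsZero (((Tor (ModuleCat.{u} R) i).obj (SasR φ)).obj (SasR φ)))
    (Y X : ModuleCat.{u} S) : ∃ (P : ModuleCat.{u} S) (p : P ⟶ X), Projective P ∧ Epi p ∧
      ∀ n, Subsingleton (Ext.{w} ((ModuleCat.restrictScalars.{u} φ).obj P)
        ((ModuleCat.restrictScalars.{u} φ).obj Y) (n + 1)) := by
  have hp : Projective (ModuleCat.of S S) :=
    (IsProjective.iff_projective S).1 inferInstance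
  refine ⟨∐ fun _ : (ModuleCat.of S S ⟶ X) => ModuleCat.of S S, Sigma.desc fun f => f,
    inferInstance, ?_, fun n => ?_⟩
  · rw [ModuleCat.epi_iff_surjective]
    intro x
    let f : ModuleCat.of S S ⟶ X := ModuleCat.ofHom (LinearMap.toSpanSingleton S X x)
    refine ⟨Sigma.ι (fun _ : (ModuleCat.of S S ⟶ X) => ModuleCat.of S S) f (1 : S), ?_⟩
    rw [← ConcreteCategory.comp_apply, Sigma.ι_desc]
    exact one_smul S x
  · have : PreservesColimitsOfSize.{u, u} (ModuleCat.restrictScalars.{u} φ) :=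
      (ModuleCat.restrictCoextendScalarsAdj.{u} φ).leftAdjoint_preservesColimits
    have hc := isColimitCofanMkObjOfIsColimit (ModuleCat.restrictScalars.{u} φ) _ _
      (coproductIsCoproduct (fun _ : (ModuleCat.of S S ⟶ X) => ModuleCat.of S S))
    exact ext_coproduct _ hc n _ fun i => ext_self_subsingleton φ h hT Y n


end Aux

variable {R S : Type u} [CommRing R] [CommRing S] (φ : R →+* S)

attribute [local instance] CategoryTheory.hasExt_of_hasDerivedCategory

variable [HasDerivedCategory.{w} (ModuleCat.{u} R)]
  [HasDerivedCategory.{w} (ModuleCat.{u} S)]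

open CategoryTheory.Abelian TensorProduct

lemma singleObjIso_eq (M : ModuleCat.{u} S) : singleObjIso φ M =
    ((ModuleCat.restrictScalars.{u} φ).mapDerivedCategorySingleFunctor 0).app M := by
  apply Iso.ext
  have e1 : (singleObjIso φ M).hom =
      (Dphi φ).map (((singleFunctorsPostcompQIso (ModuleCat.{u} S)).hom.hom 0).app M) ≫
      (ModuleCat.restrictScalars.{u} φ).mapDerivedCategoryFactors.hom.app _ ≫
      DerivedCategory.Q.map ((HomologicalComplex.singleMapHomologicalComplex
        (ModuleCat.restrictScalars.{u} φ) (ComplexShape.up ℤ) 0).hom.app M) ≫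
      ((singleFunctorsPostcompQIso (ModuleCat.{u} R)).inv.hom 0).app _ := rfl
  have e2 : (((ModuleCat.restrictScalars.{u} φ).mapDerivedCategorySingleFunctor 0).app M).hom =
      (Dphi φ).map ((singleFunctorIsoCompQ (ModuleCat.{u} S) 0).hom.app M) ≫
      𝟙 _ ≫
      (ModuleCat.restrictScalars.{u} φ).mapDerivedCategoryFactors.hom.app _ ≫
      𝟙 _ ≫
      DerivedCategory.Q.map ((HomologicalComplex.singleMapHomologicalComplex
        (ModuleCat.restrictScalars.{u} φ) (ComplexShape.up ℤ) 0).hom.app M) ≫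
      𝟙 _ ≫
      (singleFunctorIsoCompQ (ModuleCat.{u} R) 0).inv.app _ := rfl
  rw [e1, e2, singleFunctorsPostcompQIso_hom_hom, singleFunctorsPostcompQIso_inv_hom,
    Category.id_comp, Category.id_comp]
  congr 3
  exact (Category.id_comp _).symm

lemma extMap_eq {M M' : ModuleCat.{u} S} {n : ℕ} (e : Abelian.Ext.{w} M M' n) :
    extMap φ e = Ext.mapExactFunctor.{w, w} (ModuleCat.restrictScalars.{u} φ) e := by
  ext
  rw [Ext.mapExactFunctor_hom]
  change Ext.homEquiv (extMap φ e) = _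
  rw [extMap, Equiv.apply_symm_apply, singleObjIso_eq, singleObjIso_eq]
  simp [ShiftedHom.map]

/-- For a homomorphism `φ : R →+* S` of commutative rings, the multiplication map
`μ : S ⊗_R S → S` is bijective and `Tor_i^R(S,S) = 0` for all `i ≥ 1` if and only if for all
`S`-modules `M, M'` and all `i ≥ 0` the natural map `Ext^i_S(M,M') → Ext^i_R(M,M')`
induced by restriction of scalars is an isomorphism. -/
theorem mul_bijective_and_tor_vanishing_iff_extMap_bijective :
    (Function.Bijective (mulMap φ) ∧
      ∀ i : ℕ, 1 ≤ i →
        IsZero (((Tor (ModuleCat.{u} R) i).obj (SasR φ)).obj (SasR φ))) ↔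
    (∀ (M M' : ModuleCat.{u} S) (i : ℕ),
      Function.Bijective (fun e : Abelian.Ext.{w} M M' i => extMap φ e)) := by
  have hmap : ∀ (M M' : ModuleCat.{u} S) (i : ℕ),
      (fun e : Abelian.Ext.{w} M M' i => extMap φ e) =
        ⇑(Functor.mapExtAddHom.{w, w} (ModuleCat.restrictScalars.{u} φ) M M' i) := fun M M' i =>
    funext fun e => extMap_eq φ e
  simp only [hmap]
  have hfaith : (ModuleCat.restrictScalars.{u} φ).Faithful := inferInstance
  constructor
  · rintro ⟨h, hT⟩ M M' i
    have := full_of_mul φ h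
    exact mapExt_bijective.{w} _ M' (exists_cover.{w} φ h hT M') M i
  · intro H
    refine ⟨mul_of_full φ ⟨fun {M N} f => ?_⟩, fun i hi => ?_⟩
    · obtain ⟨e, he⟩ := (H M N 0).2 (Ext.mk₀ f)
      obtain ⟨g, rfl⟩ := (Ext.mk₀_bijective _ _).2 e
      refine ⟨g, (Ext.mk₀_bijective.{w} _ _).1 ?_⟩
      exact (Ext.mapExactFunctor_mk₀.{w, w} (ModuleCat.restrictScalars.{u} φ) g).symm.trans he
    · obtain ⟨n, rfl⟩ := Nat.exists_eq_add_of_le' hi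
      refine tor_of_ext.{w} φ n fun M => ?_
      have hp : Projective (ModuleCat.of S S) :=
        (IsProjective.iff_projective S).1 inferInstance
      have hs := Ext.subsingleton_of_projective.{w} (ModuleCat.of S S) M n
      exact (H (ModuleCat.of S S) M (n + 1)).2.subsingleton

end RingHomEpi
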